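/- Let ε > 0, N > 0, R > 0 with R·ln 2 ≥ (1/2)·ln N, let σ_w² > 0, σ_b² > 0, 0 < h ≤ 1, P_b^max ≥ 0, and set γ⁺ = (ε² + √(ε⁴ + 2ε²N))/N. Define for P_b ∈ [0, P_b^max] the SINR γ_b†(P_b) = γ⁺·(σ_w² + P_b)/(σ_b² + h·P_b) obtained by setting P_a = γ⁺·(σ_w² + P_b), and the effective throughput η(P_b) = N·R·(1 − Q(ζ(γ_b†(P_b)))). If σ_b² ≥ h·σ_w², then η is nondecreasing on [0, P_b^max] and attains its maximum at P_b = P_b^max; if σ_b² < h·σ_w², then η is strictly decreasing on [0, P_b^max] and attains its maximum uniquely at P_b = 0. -/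

import Mathlib

open ProbabilityTheory

/-- The Gaussian Q-function: complementary CDF of a standard real Gaussian. -/
noncomputable def gaussQ (x : ℝ) : ℝ := (gaussianReal 0 1 (Set.Ioi x)).toReal

theorem gaussQ_strictAnti : StrictAnti gaussQ := by
  intro x y hxy
  have hpos : 0 < (gaussianReal 0 1).real (Set.Ioc x y) := by
    refine ENNReal.toReal_pos (fun h0 => ?_) (MeasureTheory.measure_ne_top _ _)
    have := gaussianReal_absolutelyContinuous' 0 one_ne_zero h0
    rw [Real.volume_Ioc, ENNReal.ofReal_eq_zero] at this
    linarith
  have hsplit := MeasureTheory.measureReal_union (μ := gaussianReal 0 1)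
    (Set.Ioc_disjoint_Ioi le_rfl : Disjoint (Set.Ioc x y) (Set.Ioi y)) measurableSet_Ioi
  rw [Set.Ioc_union_Ioi_eq_Ioi hxy.le] at hsplit
  change (gaussianReal 0 1).real (Set.Ioi y) < (gaussianReal 0 1).real (Set.Ioi x)
  linarith

theorem strictMonoOn_mul_log_div_sqrt {c : ℝ} (hc : 0 ≤ c) :
    StrictMonoOn (fun γ : ℝ => (1 + γ) * (Real.log (1 + γ) - c) / Real.sqrt (γ * (γ + 2)))
      (Set.Ioi 0) := by
  have hderiv : ∀ γ : ℝ, 0 < γ →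
      HasDerivAt (fun γ : ℝ => (1 + γ) * (Real.log (1 + γ) - c) / Real.sqrt (γ * (γ + 2)))
        ((γ * (γ + 2) - (Real.log (1 + γ) - c)) / Real.sqrt (γ * (γ + 2)) ^ 3) γ := by
    intro γ hγ
    have hs : 0 < γ * (γ + 2) := by positivity
    have hs' : 0 < Real.sqrt (γ * (γ + 2)) := Real.sqrt_pos.2 hs
    have h1 : HasDerivAt (fun γ : ℝ => 1 + γ) 1 γ := (hasDerivAt_id γ).const_add 1
    have h2 := h1.mul ((h1.log (by positivity)).sub_const c)
    have h3 := ((hasDerivAt_id γ).mul ((hasDerivAt_id γ).add_const 2)).sqrt hs.ne'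
    refine (h2.div h3 hs'.ne').congr_deriv ?_
    have hsq := Real.sq_sqrt hs.le
    simp only [Pi.mul_apply, id]
    set s := Real.sqrt (γ * (γ + 2))
    have h1γ : 1 + γ ≠ 0 := by positivity
    field_simp
    rw [hsq]
    ring
  refine strictMonoOn_of_deriv_pos (convex_Ioi 0)
    (fun γ hγ => (hderiv γ hγ).continuousAt.continuousWithinAt) fun γ hγ => ?_
  rw [interior_Ioi] at hγ
  have hγ : 0 < γ := hγ
  rw [(hderiv γ hγ).deriv]
  have hlog := Real.log_le_sub_one_of_pos (show 0 < 1 + γ by positivity)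
  have : 0 < γ * (γ + 2) - (Real.log (1 + γ) - c) := by nlinarith
  positivity

/-- Theorem 2 of the paper: with γ⁺ = (ε² + √(ε⁴ + 2ε²N))/N,
γ_b†(P_b) = γ⁺·(σ_w² + P_b)/(σ_b² + h·P_b) (i.e. P_a = γ⁺·(σ_w² + P_b)), and
η(P_b) = N·R·(1 − Q(ζ(γ_b†(P_b)))): if σ_b² ≥ h·σ_w² then η is nondecreasing on
[0, P_b^max] with maximum at P_b^max; if σ_b² < h·σ_w² then η is strictly
decreasing on [0, P_b^max] with unique maximum at 0. -/
theorem stmt_16 (ε N R σw2 σb2 h Pbmax : ℝ) (hε : ε > 0) (hN : N > 0) (hR : R > 0)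
    (hRN : R * Real.log 2 ≥ (1 / 2) * Real.log N) (hσw : σw2 > 0) (hσb : σb2 > 0)
    (hh : 0 < h) (hh1 : h ≤ 1) (hPbmax : Pbmax ≥ 0) :
    let γp : ℝ := (ε ^ 2 + Real.sqrt (ε ^ 4 + 2 * ε ^ 2 * N)) / N
    let γbd : ℝ → ℝ := fun Pb => γp * (σw2 + Pb) / (σb2 + h * Pb)
    let ζ : ℝ → ℝ := fun γ =>
      Real.sqrt N * (1 + γ) * (Real.log (1 + γ) + (1 / 2) * Real.log N - R * Real.log 2) /
        Real.sqrt (γ * (γ + 2))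
    let η : ℝ → ℝ := fun Pb => N * R * (1 - gaussQ (ζ (γbd Pb)))
    (σb2 ≥ h * σw2 →
      MonotoneOn η (Set.Icc 0 Pbmax) ∧ ∀ Pb ∈ Set.Icc (0 : ℝ) Pbmax, η Pb ≤ η Pbmax) ∧
    (σb2 < h * σw2 →
      StrictAntiOn η (Set.Icc 0 Pbmax) ∧
        ∀ Pb ∈ Set.Icc (0 : ℝ) Pbmax, Pb ≠ 0 → η Pb < η 0) := by
  intro γp γbd ζ η
  have hγp : 0 < γp := by positivity
  have hden : ∀ {P : ℝ}, 0 ≤ P → 0 < σb2 + h * P := fun hP => by positivity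
  have hγpos : ∀ {P : ℝ}, 0 ≤ P → γbd P ∈ Set.Ioi (0 : ℝ) := fun {P} hP =>
    show 0 < γp * (σw2 + P) / (σb2 + h * P) by positivity
  have hζ : StrictMonoOn ζ (Set.Ioi 0) := by
    intro x hx y hy hxy
    have := mul_lt_mul_of_pos_left (strictMonoOn_mul_log_div_sqrt
      (c := R * Real.log 2 - (1 / 2) * Real.log N) (by linarith) hx hy hxy) (Real.sqrt_pos.2 hN)
    convert this using 1 <;> simp only [ζ] <;> ring
  have hη : StrictMono fun z => N * R * (1 - gaussQ z) := fun x y hxy =>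
    mul_lt_mul_of_pos_left (sub_lt_sub_left (gaussQ_strictAnti hxy) 1) (by positivity)
  constructor
  · intro hσ
    have hmono : MonotoneOn η (Set.Icc 0 Pbmax) := by
      intro x hx y hy hxy
      refine hη.monotone (hζ.monotoneOn (hγpos hx.1) (hγpos hy.1) ?_)
      simp only [γbd]
      rw [div_le_div_iff₀ (hden hx.1) (hden hy.1), mul_assoc, mul_assoc]
      refine mul_le_mul_of_nonneg_left ?_ hγp.le
      nlinarith [mul_nonneg (sub_nonneg.2 hσ) (sub_nonneg.2 hxy)]
    exact ⟨hmono, fun P hP => hmono hP (Set.right_mem_Icc.2 hPbmax) hP.2⟩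
  · intro hσ
    have hanti : StrictAntiOn η (Set.Icc 0 Pbmax) := by
      intro x hx y hy hxy
      refine hη (hζ (hγpos hy.1) (hγpos hx.1) ?_)
      simp only [γbd]
      rw [div_lt_div_iff₀ (hden hy.1) (hden hx.1), mul_assoc, mul_assoc]
      refine mul_lt_mul_of_pos_left ?_ hγp
      nlinarith [mul_pos (sub_pos.2 hσ) (sub_pos.2 hxy)]
    exact ⟨hanti, fun P hP hP0 =>
      hanti (Set.left_mem_Icc.2 hPbmax) hP (lt_of_le_of_ne hP.1 hP0.symm)⟩
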